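/- Let X be a spectrally negative Lévy process with paths of bounded variation satisfying the net profit condition. For any q ≥ 0, b > 0 and any nonnegative random variable Y independent of X, one has W^{(q)}(0+) · 𝔼[∫_0^∞ H^{(q)}(b,y) ∫_{(−y−Y,−y)} (W^{(q)}(y+x+Y)/W^{(q)}(Y)) Π(dx) dy] < 1; in particular the denominator in the Gerber–Shiu formula of the bounded variation case, namely 1/W^{(q)}(0+) − 𝔼[∫_0^∞ H^{(q)}(b,y) ∫_{(−y−Y,−y)} (W^{(q)}(y+x+Y)/W^{(q)}(Y)) Π(dx) dy], is strictly positive. -/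

import Mathlib

open MeasureTheory ProbabilityTheory Set Filter
open scoped ENNReal

noncomputable section

/-- A spectrally negative Lévy process: a family of laws `P x` (the process started at `x`),
the process `X`, its left limits `Xlim`, Laplace exponent `ψ`, right inverse `Φ`,
Gaussian coefficient `σ2`, Lévy measure `levyMeasure`, and the scale functions `W` together
with (a version of) their derivatives/densities `W'`. -/
structure SNLevy (Ω : Type) [MeasurableSpace Ω] where
  P : ℝ → Measure Ω
  probP : ∀ x, IsProbabilityMeasure (P x)
  X : ℝ → Ω → ℝ
  measX : ∀ t : ℝ, Measurable (X t)
  start : ∀ x : ℝ, ∀ᵐ ω ∂ P x, X 0 ω = x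
  rightCont : ∀ x : ℝ, ∀ᵐ ω ∂ P x, ∀ t : ℝ, 0 ≤ t →
      Filter.Tendsto (fun s => X s ω) (nhdsWithin t (Set.Ioi t)) (nhds (X t ω))
  Xlim : ℝ → Ω → ℝ
  leftLimit : ∀ x : ℝ, ∀ᵐ ω ∂ P x, ∀ t : ℝ, 0 < t →
      Filter.Tendsto (fun s => X s ω) (nhdsWithin t (Set.Iio t)) (nhds (Xlim t ω))
  spatialHom : ∀ x t : ℝ, 0 ≤ t → (P x).map (X t) = (P 0).map (fun ω => x + X t ω)
  stationaryInc : ∀ x s t : ℝ, 0 ≤ s → 0 ≤ t →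
      (P x).map (fun ω => X (s + t) ω - X s ω) = (P 0).map (X t)
  indepInc : ∀ x s t : ℝ, 0 ≤ s → 0 ≤ t →
      ProbabilityTheory.Indep
        (MeasurableSpace.comap (fun ω => X (s + t) ω - X s ω) inferInstance)
        (⨆ u ∈ Set.Icc (0 : ℝ) s, MeasurableSpace.comap (X u) inferInstance) (P x)
  noPosJumps : ∀ x : ℝ, ∀ᵐ ω ∂ P x, ∀ t : ℝ, 0 < t → X t ω ≤ Xlim t ω
  notNegSubordinator : ¬ (∀ᵐ ω ∂ P 0, ∀ s t : ℝ, 0 ≤ s → s ≤ t → X t ω ≤ X s ω)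
  ψ : ℝ → ℝ
  laplaceExp : ∀ lam : ℝ, 0 ≤ lam → ∀ t : ℝ, 0 ≤ t →
      ∫ ω, Real.exp (lam * X t ω) ∂ P 0 = Real.exp (ψ lam * t)
  Φ : ℝ → ℝ
  Φdef : ∀ θ : ℝ, 0 ≤ θ → Φ θ = sSup {lam : ℝ | 0 ≤ lam ∧ ψ lam = θ}
  γ : ℝ
  σ2 : ℝ
  σ2nonneg : 0 ≤ σ2
  levyMeasure : Measure ℝ
  levySupp : levyMeasure (Set.Ici 0) = 0
  levyInt : ∫⁻ y, ENNReal.ofReal (min 1 (y ^ 2)) ∂levyMeasure ≠ ∞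
  levyKhintchine : ∀ lam : ℝ, 0 ≤ lam →
      ψ lam = γ * lam + σ2 / 2 * lam ^ 2 +
        ∫ y, (Real.exp (lam * y) - 1 - lam * y * (if -1 < y then 1 else 0)) ∂levyMeasure
  W : ℝ → ℝ → ℝ
  Wnonneg : ∀ θ : ℝ, 0 ≤ θ → ∀ y : ℝ, 0 ≤ W θ y
  Wzero : ∀ θ : ℝ, 0 ≤ θ → ∀ y : ℝ, y < 0 → W θ y = 0
  Wcont : ∀ θ : ℝ, 0 ≤ θ → ContinuousOn (W θ) (Set.Ioi 0)
  Wmeas : ∀ θ : ℝ, 0 ≤ θ → Measurable (W θ)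
  Wlaplace : ∀ θ : ℝ, 0 ≤ θ → ∀ lam : ℝ, Φ θ < lam →
      ∫ y in Set.Ioi (0 : ℝ), Real.exp (-lam * y) * W θ y = 1 / (ψ lam - θ)
  Wuniq : ∀ θ : ℝ, 0 ≤ θ → ∀ V : ℝ → ℝ, ContinuousOn V (Set.Ioi 0) →
      (∀ lam : ℝ, Φ θ < lam →
        ∫ y in Set.Ioi (0 : ℝ), Real.exp (-lam * y) * V y = 1 / (ψ lam - θ)) →
      Set.EqOn V (W θ) (Set.Ioi 0)
  W' : ℝ → ℝ → ℝ
  Wabscont : ∀ θ : ℝ, 0 ≤ θ → ∀ y : ℝ, 0 ≤ y →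
      W θ y = W θ 0 + ∫ z in Set.Ioc (0 : ℝ) y, W' θ z

namespace SNLevy

variable {Ω : Type} [MeasurableSpace Ω] (L : SNLevy Ω)

/-- First passage time above level `a`: `τ_a^+ = inf {t > 0 : X_t > a}`, valued in `ℝ≥0∞`
(`⊤` when the level is never passed). -/
def tauAbove (a : ℝ) (ω : Ω) : ℝ≥0∞ :=
  sInf {t : ℝ≥0∞ | t ≠ ⊤ ∧ 0 < t ∧ a < L.X t.toReal ω}

/-- First passage time below level `a`: `τ_a^- = inf {t > 0 : X_t < a}`. -/
def tauBelow (a : ℝ) (ω : Ω) : ℝ≥0∞ :=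
  sInf {t : ℝ≥0∞ | t ≠ ⊤ ∧ 0 < t ∧ L.X t.toReal ω < a}

/-- `𝒲^{(θ)}(a,x,y) = W^{(θ)}(x) W^{(θ)}(a-y)/W^{(θ)}(a) - W^{(θ)}(x-y)`. -/
def scrW (θ a x y : ℝ) : ℝ :=
  L.W θ x * L.W θ (a - y) / L.W θ a - L.W θ (x - y)

/-- `𝒪^{(θ)}(a,x) = W^{(θ)'}(x) - W^{(θ)}(x) W^{(θ)'}(a)/W^{(θ)}(a)`. -/
def scrO (θ a x : ℝ) : ℝ :=
  L.W' θ x - L.W θ x * L.W' θ a / L.W θ a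

/-- `H^{(θ)}(b,x) = W^{(θ)}(b-x)/W^{(θ)}(b) - e^{Φ(θ)b} W^{(θ)}(-x)/W^{(θ)}(b)`. -/
def H (θ b x : ℝ) : ℝ :=
  L.W θ (b - x) / L.W θ b - Real.exp (L.Φ θ * b) * L.W θ (-x) / L.W θ b

end SNLevy

/-- `e^{-q t} 1_{t < ∞}` for an extended-real time `t`. -/
def eNeg (q : ℝ) (t : ℝ≥0∞) : ℝ :=
  if t = ⊤ then 0 else Real.exp (-q * t.toReal)

namespace SNLevy

variable {Ω : Type} [MeasurableSpace Ω] (L : SNLevy Ω)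

def tl (z : ℝ) : ℝ := L.levyMeasure.real (Iic (-z))

def cc : ℝ := L.γ - ∫ u, u * (if -1 < u then 1 else 0) ∂L.levyMeasure

lemma ae_neg : ∀ᵐ u ∂L.levyMeasure, u < 0 := by
  rw [ae_iff]
  have : {a : ℝ | ¬ a < 0} = Ici 0 := by ext; simp
  rw [this]; exact L.levySupp

lemma tail_fin {z : ℝ} (hz : 0 < z) : L.levyMeasure (Iic (-z)) ≠ ⊤ := by
  have hpos : 0 < min 1 (z ^ 2) := lt_min one_pos (by positivity)
  have h := mul_meas_ge_le_lintegral₀ (μ := L.levyMeasure)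
    (f := fun y => ENNReal.ofReal (min 1 (y ^ 2))) (by fun_prop) (ENNReal.ofReal (min 1 (z^2)))
  have hsub : L.levyMeasure (Iic (-z)) ≤
      L.levyMeasure {x | ENNReal.ofReal (min 1 (z^2)) ≤ ENNReal.ofReal (min 1 (x^2))} := by
    apply measure_mono
    intro u hu
    simp only [mem_Iic] at hu
    apply ENNReal.ofReal_le_ofReal
    apply min_le_min le_rfl
    nlinarith
  intro htop
  rw [htop, top_le_iff] at hsub
  rw [hsub, ENNReal.mul_top (by simpa using hz.ne'), top_le_iff] at h
  exact L.levyInt h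

lemma tl_nonneg (z : ℝ) : 0 ≤ L.tl z := measureReal_nonneg

lemma tl_anti {x y : ℝ} (hx : 0 < x) (hxy : x ≤ y) : L.tl y ≤ L.tl x :=
  measureReal_mono (Iic_subset_Iic.2 (by linarith)) (L.tail_fin hx)

lemma tl_meas : Measurable L.tl := by
  have : Antitone (fun z : ℝ => L.levyMeasure (Iic (-z))) := fun x y hxy =>
    measure_mono (Iic_subset_Iic.2 (by linarith))
  exact this.measurable.ennreal_toReal

lemma int_small
    (hBVPi : ∫⁻ y in Set.Ioo (-1 : ℝ) 0, ENNReal.ofReal (-y) ∂ L.levyMeasure ≠ ⊤) :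
    Integrable (fun u : ℝ => u * (if -1 < u then 1 else 0)) L.levyMeasure := by
  have h1 : IntegrableOn (fun u : ℝ => u) (Ioo (-1) 0) L.levyMeasure := by
    refine ⟨by fun_prop, ?_⟩
    rw [hasFiniteIntegral_iff_norm]
    refine lt_of_le_of_lt (le_of_eq ?_) (lt_top_iff_ne_top.2 hBVPi)
    refine setLIntegral_congr_fun measurableSet_Ioo (fun u hu => ?_)
    simp only [Real.norm_eq_abs, abs_of_neg hu.2]
  have h2 := (integrable_indicator_iff (measurableSet_Ioo)).2 h1
  refine h2.congr ?_
  filter_upwards [L.ae_neg] with u hu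
  by_cases h : -1 < u <;> simp [indicator, h, hu]

lemma int_exp
    (hBVPi : ∫⁻ y in Set.Ioo (-1 : ℝ) 0, ENNReal.ofReal (-y) ∂ L.levyMeasure ≠ ⊤)
    {lam : ℝ} (hl : 0 ≤ lam) :
    Integrable (fun u : ℝ => 1 - Real.exp (lam * u)) L.levyMeasure := by
  have h1 : Integrable ((Iic (-1 : ℝ)).indicator (fun _ => (1 : ℝ))) L.levyMeasure := by
    rw [integrable_indicator_iff measurableSet_Iic]
    have := L.tail_fin one_pos
    exact integrableOn_const this
  have h2 := h1.sub ((L.int_small hBVPi).const_mul lam)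
  refine h2.mono' (by fun_prop) ?_
  filter_upwards [L.ae_neg] with u hu
  have hlu : lam * u ≤ 0 := mul_nonpos_of_nonneg_of_nonpos hl hu.le
  have he : Real.exp (lam * u) ≤ 1 := Real.exp_le_one_iff.2 hlu
  have hp := Real.exp_pos (lam * u)
  have := Real.add_one_le_exp (lam * u)
  rw [Real.norm_eq_abs, abs_of_nonneg (by linarith)]
  by_cases h : -1 < u
  · have : ¬ u ≤ -1 := by linarith
    simp [indicator, h, this]; linarith
  · have : u ≤ -1 := by linarith
    simp [indicator, h, this]; linarith

lemma psi_eq (hBVσ : L.σ2 = 0)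
    (hBVPi : ∫⁻ y in Set.Ioo (-1 : ℝ) 0, ENNReal.ofReal (-y) ∂ L.levyMeasure ≠ ⊤)
    {lam : ℝ} (hl : 0 ≤ lam) :
    L.ψ lam = L.cc * lam - ∫ u, (1 - Real.exp (lam * u)) ∂L.levyMeasure := by
  rw [L.levyKhintchine lam hl, hBVσ, cc]
  have : (fun y : ℝ => (Real.exp (lam * y) - 1 - lam * y * (if -1 < y then 1 else 0)))
      = fun y => -(1 - Real.exp (lam * y)) - lam * (y * (if -1 < y then 1 else 0)) := by
    ext y; ring
  have h2 : ∫ y, (-(1 - Real.exp (lam * y)) - lam * (y * (if -1 < y then 1 else 0)))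
      ∂L.levyMeasure = (∫ y, -(1 - Real.exp (lam * y)) ∂L.levyMeasure) -
      ∫ y, lam * (y * (if -1 < y then 1 else 0)) ∂L.levyMeasure :=
    integral_sub (L.int_exp hBVPi hl).neg ((L.int_small hBVPi).const_mul lam)
  rw [this, h2, integral_neg, integral_const_mul]
  ring

lemma lap_lint {lam : ℝ} (hl : 0 < lam) :
    ∫⁻ u, ENNReal.ofReal ((1 - Real.exp (lam * u)) / lam) ∂L.levyMeasure =
      ∫⁻ t in Ioi 0, ENNReal.ofReal (Real.exp (-lam * t) * L.tl t) := by
  have h := lintegral_comp_eq_lintegral_meas_le_mul (μ := L.levyMeasure)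
    (f := fun u : ℝ => -u) (g := fun t => Real.exp (-lam * t))
    (by filter_upwards [L.ae_neg] with u hu; simp; exact hu.le) (by fun_prop)
    (fun t _ => (by fun_prop : Continuous fun t => Real.exp (-lam * t)).intervalIntegrable _ _)
    (ae_of_all _ fun t => (Real.exp_pos _).le)
  have e1 : ∀ u : ℝ, ∫ t in (0:ℝ)..(-u), Real.exp (-lam * t) = (1 - Real.exp (lam * u)) / lam := by
    intro u
    rw [intervalIntegral.integral_comp_mul_left (fun x => Real.exp x) (neg_ne_zero.2 hl.ne'), integral_exp]
    simp
    field_simp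
    ring
  simp only [e1] at h
  rw [h]
  refine setLIntegral_congr_fun measurableSet_Ioi (fun t ht => ?_)
  have : {a : ℝ | t ≤ -a} = Iic (-t) := by ext a; simp [le_neg]
  simp only [this]
  rw [ENNReal.ofReal_mul (Real.exp_pos _).le, mul_comm, tl, ofReal_measureReal (L.tail_fin ht)]

lemma lap_tl
    (hBVPi : ∫⁻ y in Set.Ioo (-1 : ℝ) 0, ENNReal.ofReal (-y) ∂ L.levyMeasure ≠ ⊤)
    {lam : ℝ} (hl : 0 < lam) :
    IntegrableOn (fun t => Real.exp (-lam * t) * L.tl t) (Ioi 0) ∧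
    ∫ u, (1 - Real.exp (lam * u)) ∂L.levyMeasure =
      lam * ∫ t in Ioi 0, Real.exp (-lam * t) * L.tl t := by
  have hm : Measurable (fun t => Real.exp (-lam * t) * L.tl t) := by
    have := L.tl_meas
    fun_prop
  have hi := (L.int_exp hBVPi hl.le).div_const lam
  have hn : 0 ≤ᵐ[L.levyMeasure] fun u => (1 - Real.exp (lam * u)) / lam := by
    filter_upwards [L.ae_neg] with u hu
    have he : Real.exp (lam * u) ≤ 1 :=
      Real.exp_le_one_iff.2 (mul_nonpos_of_nonneg_of_nonpos hl.le hu.le)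
    exact div_nonneg (by linarith) hl.le
  have hn2 : ∀ t, 0 ≤ Real.exp (-lam * t) * L.tl t :=
    fun t => mul_nonneg (Real.exp_pos _).le (L.tl_nonneg t)
  constructor
  · refine ⟨hm.aestronglyMeasurable, ?_⟩
    rw [hasFiniteIntegral_iff_ofReal (ae_of_all _ hn2), ← L.lap_lint hl]
    exact (hasFiniteIntegral_iff_ofReal hn).1 hi.2
  · have h1 := integral_eq_lintegral_of_nonneg_ae hn hi.1
    have h2 := integral_eq_lintegral_of_nonneg_ae (μ := volume.restrict (Ioi 0)) (ae_of_all _ hn2)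
      hm.aestronglyMeasurable
    rw [L.lap_lint hl, ← h2, integral_div] at h1
    rw [← h1]; field_simp

def KK (lam : ℝ) : ℝ := ∫ t in Ioi 0, Real.exp (-lam * t) * L.tl t

lemma psi_eq' (hBVσ : L.σ2 = 0)
    (hBVPi : ∫⁻ y in Set.Ioo (-1 : ℝ) 0, ENNReal.ofReal (-y) ∂ L.levyMeasure ≠ ⊤)
    {lam : ℝ} (hl : 0 < lam) : L.ψ lam = lam * (L.cc - L.KK lam) := by
  rw [L.psi_eq hBVσ hBVPi hl.le, (L.lap_tl hBVPi hl).2, KK]; ring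

lemma KK_anti
    (hBVPi : ∫⁻ y in Set.Ioo (-1 : ℝ) 0, ENNReal.ofReal (-y) ∂ L.levyMeasure ≠ ⊤)
    {a b : ℝ} (ha : 0 < a) (hab : a ≤ b) : L.KK b ≤ L.KK a := by
  refine setIntegral_mono_on (L.lap_tl hBVPi (ha.trans_le hab)).1 (L.lap_tl hBVPi ha).1
    measurableSet_Ioi (fun t ht => ?_)
  refine mul_le_mul_of_nonneg_right (Real.exp_le_exp.2 ?_) (L.tl_nonneg t)
  have : (0:ℝ) < t := ht
  nlinarith

lemma KK_nonneg (a : ℝ) : 0 ≤ L.KK a :=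
  integral_nonneg fun t => mul_nonneg (Real.exp_pos _).le (L.tl_nonneg t)

lemma exists_pos (hBVσ : L.σ2 = 0)
    (hBVPi : ∫⁻ y in Set.Ioo (-1 : ℝ) 0, ENNReal.ofReal (-y) ∂ L.levyMeasure ≠ ⊤)
    (hNP : 0 < derivWithin L.ψ (Set.Ici 0) 0) : ∃ lam, 0 < lam ∧ 0 < L.ψ lam := by
  have h0 : L.ψ 0 = 0 := by
    rw [L.psi_eq hBVσ hBVPi le_rfl]; simp
  have hd : DifferentiableWithinAt ℝ L.ψ (Ici 0) 0 :=
    differentiableWithinAt_of_derivWithin_ne_zero hNP.ne'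
  have h := hd.hasDerivWithinAt
  rw [hasDerivWithinAt_iff_tendsto_slope] at h
  have h2 := h.eventually (lt_mem_nhds hNP)
  have h3 : Ici (0:ℝ) \ {0} = Ioi 0 := by
    ext x; simp [lt_iff_le_and_ne, eq_comm]
  rw [h3] at h2
  obtain ⟨x, hx, hx0⟩ := (h2.and self_mem_nhdsWithin).exists
  have hx0 : (0:ℝ) < x := hx0
  refine ⟨x, hx0, ?_⟩
  simp only [slope, h0, vsub_eq_sub, sub_zero, smul_eq_mul] at hx
  exact (pos_iff_pos_of_mul_pos hx).1 (by positivity)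

lemma cc_pos (hBVσ : L.σ2 = 0)
    (hBVPi : ∫⁻ y in Set.Ioo (-1 : ℝ) 0, ENNReal.ofReal (-y) ∂ L.levyMeasure ≠ ⊤)
    (hNP : 0 < derivWithin L.ψ (Set.Ici 0) 0) : 0 < L.cc := by
  obtain ⟨l, hl, h⟩ := L.exists_pos hBVσ hBVPi hNP
  rw [L.psi_eq' hBVσ hBVPi hl] at h
  have := (pos_iff_pos_of_mul_pos h).1 hl
  have := L.KK_nonneg l
  linarith

lemma Phi_facts (hBVσ : L.σ2 = 0)
    (hBVPi : ∫⁻ y in Set.Ioo (-1 : ℝ) 0, ENNReal.ofReal (-y) ∂ L.levyMeasure ≠ ⊤)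
    (hNP : 0 < derivWithin L.ψ (Set.Ici 0) 0)
    {q : ℝ} (hq : 0 ≤ q) {lam : ℝ} (hl : L.Φ q < lam) :
    0 < lam ∧ IntegrableOn (fun y => Real.exp (-lam * y) * L.W q y) (Ioi 0) ∧ q < L.ψ lam := by
  have hΦ : 0 ≤ L.Φ q := by
    rw [L.Φdef q hq]
    exact Real.sSup_nonneg fun x hx => hx.1
  have hlp : 0 < lam := hΦ.trans_lt hl
  have hne : L.ψ lam ≠ q := by
    intro he
    obtain ⟨l, hl0, h⟩ := L.exists_pos hBVσ hBVPi hNP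
    rw [L.psi_eq' hBVσ hBVPi hl0] at h
    have hp := (pos_iff_pos_of_mul_pos h).1 hl0
    have hbdd : BddAbove {lam : ℝ | 0 ≤ lam ∧ L.ψ lam = q} := by
      refine ⟨max l (q / (L.cc - L.KK l)), fun x hx => ?_⟩
      by_contra hcon
      push Not at hcon
      have h1 : l < x := (le_max_left _ _).trans_lt hcon
      have h2 : q / (L.cc - L.KK l) < x := (le_max_right _ _).trans_lt hcon
      rw [div_lt_iff₀ hp] at h2
      have h3 := hx.2
      rw [L.psi_eq' hBVσ hBVPi (hl0.trans h1)] at h3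
      have := L.KK_anti hBVPi hl0 h1.le
      nlinarith
    have := le_csSup hbdd (show lam ∈ _ from ⟨hlp.le, he⟩)
    rw [← L.Φdef q hq] at this
    linarith
  have hW := L.Wlaplace q hq lam hl
  refine ⟨hlp, ?_, ?_⟩
  · by_contra hcon
    rw [integral_undef hcon] at hW
    have : 1 / (L.ψ lam - q) ≠ 0 := one_div_ne_zero (sub_ne_zero.2 hne)
    exact this hW.symm
  · have h0 : 0 ≤ 1 / (L.ψ lam - q) := by
      rw [← hW]
      exact integral_nonneg fun y => mul_nonneg (Real.exp_pos _).le (L.Wnonneg q hq y)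
    have := one_div_nonneg.1 h0
    exact lt_of_le_of_ne (by linarith) (Ne.symm hne)

lemma Wcont0 {q : ℝ} (hq : 0 ≤ q) : ContinuousOn (L.W q) (Ici 0) := by
  intro x hx
  rcases eq_or_lt_of_le (show (0:ℝ) ≤ x from hx) with h | h
  · subst h
    by_cases hi : ∃ y, 0 < y ∧ IntegrableOn (L.W' q) (Ioc 0 y)
    · obtain ⟨y, hy, hi⟩ := hi
      have h1 := intervalIntegral.continuousOn_primitive (μ := volume)
        ((integrableOn_Icc_iff_integrableOn_Ioc).2 hi)
      have h2 : ContinuousOn (L.W q) (Icc 0 y) :=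
        (continuousOn_const.add h1).congr fun z hz => L.Wabscont q hq z hz.1
      exact (h2 0 ⟨le_rfl, hy.le⟩).mono_of_mem_nhdsWithin (Icc_mem_nhdsGE hy)
    · push Not at hi
      have : ∀ z ∈ Ici (0:ℝ), L.W q z = L.W q 0 := by
        intro z hz
        rcases eq_or_lt_of_le (show (0:ℝ) ≤ z from hz) with h | h
        · rw [← h]
        · rw [L.Wabscont q hq z hz, integral_undef (hi z h)]; simp
      exact (continuousOn_const.congr this) 0 (by simp)
  · exact ((L.Wcont q hq).continuousAt (Ioi_mem_nhds h)).continuousWithinAt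

lemma W_contAt {q : ℝ} (hq : 0 ≤ q) {x : ℝ} (hx : x ≠ 0) : ContinuousAt (L.W q) x := by
  rcases lt_or_gt_of_ne hx with h | h
  · have : (fun _ => (0:ℝ)) =ᶠ[nhds x] L.W q := by
      filter_upwards [Iio_mem_nhds h] with y hy
      rw [L.Wzero q hq y hy]
    exact continuousAt_const.congr this
  · exact (L.Wcont q hq).continuousAt (Ioi_mem_nhds h)

lemma W_bdd {q : ℝ} (hq : 0 ≤ q) (T : ℝ) : ∃ M, 0 ≤ M ∧ ∀ x ≤ T, L.W q x ≤ M := by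
  obtain ⟨M, hM⟩ := (isCompact_Icc (a := (0:ℝ)) (b := T)).exists_bound_of_continuousOn
    ((L.Wcont0 hq).mono Icc_subset_Ici_self)
  refine ⟨max M 0, le_max_right _ _, fun x hx => ?_⟩
  rcases lt_or_ge x 0 with h | h
  · rw [L.Wzero q hq x h]; exact le_max_right _ _
  · exact (le_abs_self _).trans ((hM x ⟨h, hx⟩).trans (le_max_left _ _))

lemma tl_int
    (hBVPi : ∫⁻ y in Set.Ioo (-1 : ℝ) 0, ENNReal.ofReal (-y) ∂ L.levyMeasure ≠ ⊤) (q T : ℝ) :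
    IntegrableOn (fun z => L.tl z + q) (Ioc 0 T) := by
  have h1 : IntegrableOn L.tl (Ioc 0 T) := by
    have h := ((L.lap_tl hBVPi one_pos).1.mono_set (fun z (hz : z ∈ Ioc 0 T) => hz.1)).const_mul
      (Real.exp T)
    refine h.mono' L.tl_meas.aestronglyMeasurable ?_
    filter_upwards [ae_restrict_mem measurableSet_Ioc] with z hz
    rw [Real.norm_eq_abs, abs_of_nonneg (L.tl_nonneg z), ← mul_assoc, ← Real.exp_add]
    refine le_mul_of_one_le_left (L.tl_nonneg z) (Real.one_le_exp ?_)
    have := hz.2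
    linarith
  exact h1.add (integrableOn_const (by simp))

def conv (q x : ℝ) : ℝ := ∫ z in Ioi 0, (L.tl z + q) * L.W q (x - z)

lemma conv_bound {q : ℝ} (hq : 0 ≤ q) {T M : ℝ} (hM0 : 0 ≤ M) (hM : ∀ x ≤ T, L.W q x ≤ M)
    {x z : ℝ} (hx : x ≤ T) (hz : 0 < z) :
    ‖(L.tl z + q) * L.W q (x - z)‖ ≤ (Ioc 0 T).indicator (fun z => (L.tl z + q)) z * M := by
  have hk : 0 ≤ L.tl z + q := add_nonneg (L.tl_nonneg z) hq
  rw [Real.norm_eq_abs, abs_of_nonneg (mul_nonneg hk (L.Wnonneg q hq _))]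
  by_cases h : z ≤ T
  · rw [indicator_of_mem (show z ∈ Ioc 0 T from ⟨hz, h⟩)]
    exact mul_le_mul_of_nonneg_left (hM _ (by linarith)) hk
  · rw [indicator_of_notMem (fun h' => h h'.2), L.Wzero q hq _ (by linarith)]; simp

lemma conv_bint
    (hBVPi : ∫⁻ y in Set.Ioo (-1 : ℝ) 0, ENNReal.ofReal (-y) ∂ L.levyMeasure ≠ ⊤) (q T M : ℝ) :
    IntegrableOn (fun z => (Ioc 0 T).indicator (fun z => (L.tl z + q)) z * M) (Ioi 0) := by
  have := (integrable_indicator_iff measurableSet_Ioc).2 (L.tl_int hBVPi q T)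
  exact (this.mul_const M).integrableOn

lemma conv_meas {q : ℝ} (hq : 0 ≤ q) (x : ℝ) :
    Measurable (fun z => (L.tl z + q) * L.W q (x - z)) := by
  have h1 := L.tl_meas
  have h2 := L.Wmeas q hq
  fun_prop

lemma conv_int
    (hBVPi : ∫⁻ y in Set.Ioo (-1 : ℝ) 0, ENNReal.ofReal (-y) ∂ L.levyMeasure ≠ ⊤)
    {q : ℝ} (hq : 0 ≤ q) (x : ℝ) :
    IntegrableOn (fun z => (L.tl z + q) * L.W q (x - z)) (Ioi 0) := by
  obtain ⟨M, hM0, hM⟩ := L.W_bdd hq x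
  refine (L.conv_bint hBVPi q x M).mono' (L.conv_meas hq x).aestronglyMeasurable ?_
  filter_upwards [ae_restrict_mem measurableSet_Ioi] with z hz
  exact L.conv_bound hq hM0 hM le_rfl hz

lemma conv_cont
    (hBVPi : ∫⁻ y in Set.Ioo (-1 : ℝ) 0, ENNReal.ofReal (-y) ∂ L.levyMeasure ≠ ⊤)
    {q : ℝ} (hq : 0 ≤ q) : Continuous (L.conv q) := by
  rw [continuous_iff_continuousAt]
  intro x
  obtain ⟨M, hM0, hM⟩ := L.W_bdd hq (x + 1)
  refine continuousAt_of_dominated (μ := volume.restrict (Ioi 0))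
    (Eventually.of_forall fun y => (L.conv_meas hq y).aestronglyMeasurable)
    ?_ (L.conv_bint hBVPi q (x + 1) M) ?_
  · filter_upwards [Iic_mem_nhds (lt_add_one x)] with y hy
    filter_upwards [ae_restrict_mem measurableSet_Ioi] with z hz
    exact L.conv_bound hq hM0 hM hy hz
  · have : ∀ᵐ z : ℝ ∂(volume.restrict (Ioi 0)), z ≠ x := by
      apply ae_restrict_of_ae
      simp [ae_iff]
    filter_upwards [this] with z hz
    have h1 : ContinuousAt (L.W q) (x - z) := L.W_contAt hq (sub_ne_zero.2 hz.symm)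
    have h2 : ContinuousAt (fun y : ℝ => L.W q (y - z)) x :=
      ContinuousAt.comp (f := fun y : ℝ => y - z) h1 (by fun_prop)
    exact continuousAt_const.mul h2

lemma conv_zero {q : ℝ} (hq : 0 ≤ q) : L.conv q 0 = 0 := by
  refine setIntegral_eq_zero_of_forall_eq_zero fun z hz => ?_
  have : (0:ℝ) < z := hz
  rw [L.Wzero q hq _ (by linarith)]; simp

lemma lap_k
    (hBVPi : ∫⁻ y in Set.Ioo (-1 : ℝ) 0, ENNReal.ofReal (-y) ∂ L.levyMeasure ≠ ⊤)
    (q : ℝ) {lam : ℝ} (hl : 0 < lam) :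
    IntegrableOn (fun t => Real.exp (-lam * t) * (L.tl t + q)) (Ioi 0) ∧
    ∫ t in Ioi 0, Real.exp (-lam * t) * (L.tl t + q) = L.KK lam + q / lam := by
  have h1 := (L.lap_tl hBVPi hl).1
  have h2 : IntegrableOn (fun t => Real.exp (-lam * t) * q) (Ioi 0) :=
    (integrableOn_exp_mul_Ioi (neg_lt_zero.2 hl) 0).mul_const q
  have e : (fun t => Real.exp (-lam * t) * (L.tl t + q)) =
    fun t => Real.exp (-lam * t) * L.tl t + Real.exp (-lam * t) * q := by ext t; ring
  rw [e]
  refine ⟨h1.add h2, ?_⟩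
  rw [integral_add h1 h2, integral_mul_const, integral_exp_mul_Ioi (neg_lt_zero.2 hl) 0, KK]
  simp
  field_simp

lemma lap_conv
    (hBVPi : ∫⁻ y in Set.Ioo (-1 : ℝ) 0, ENNReal.ofReal (-y) ∂ L.levyMeasure ≠ ⊤)
    {q : ℝ} (hq : 0 ≤ q) {lam : ℝ} (hl : 0 < lam)
    (hW : IntegrableOn (fun y => Real.exp (-lam * y) * L.W q y) (Ioi 0)) :
    IntegrableOn (fun x => Real.exp (-lam * x) * L.conv q x) (Ioi 0) ∧
    ∫ x in Ioi 0, Real.exp (-lam * x) * L.conv q x =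
      (L.KK lam + q / lam) * ∫ y in Ioi 0, Real.exp (-lam * y) * L.W q y := by
  obtain ⟨hk, hkv⟩ := L.lap_k hBVPi q hl
  set f : ℝ → ℝ := (Ioi 0).indicator (fun t => Real.exp (-lam * t) * (L.tl t + q)) with hf
  set g : ℝ → ℝ := (Ioi 0).indicator (fun y => Real.exp (-lam * y) * L.W q y) with hg
  have hfi : Integrable f := (integrable_indicator_iff measurableSet_Ioi).2 hk
  have hgi : Integrable g := (integrable_indicator_iff measurableSet_Ioi).2 hW
  have hc := hfi.integrable_convolution (ContinuousLinearMap.mul ℝ ℝ) hgi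
  have hv := integral_convolution (ContinuousLinearMap.mul ℝ ℝ) hfi hgi
  have key : MeasureTheory.convolution f g (ContinuousLinearMap.mul ℝ ℝ) volume =
      (Ioi 0).indicator (fun x => Real.exp (-lam * x) * L.conv q x) := by
    ext x
    rw [convolution_def]
    simp only [ContinuousLinearMap.mul_apply']
    by_cases hx : 0 < x
    · rw [indicator_of_mem (show x ∈ Ioi 0 from hx), conv, ← integral_const_mul,
        ← integral_indicator measurableSet_Ioi]
      have : ∀ᵐ t : ℝ, t ≠ x := by simp [ae_iff]
      refine integral_congr_ae ?_
      filter_upwards [this] with t ht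
      by_cases ht0 : 0 < t
      · rw [indicator_of_mem (show t ∈ Ioi 0 from ht0), hf, hg,
          indicator_of_mem (show t ∈ Ioi 0 from ht0)]
        by_cases htx : t < x
        · rw [indicator_of_mem (show x - t ∈ Ioi 0 by simpa using htx)]
          have : Real.exp (-lam * x) = Real.exp (-lam * t) * Real.exp (-lam * (x - t)) := by
            rw [← Real.exp_add]; ring_nf
          rw [this]; ring
        · have h1 : x < t := lt_of_le_of_ne (not_lt.1 htx) (Ne.symm ht)
          rw [L.Wzero q hq (x - t) (by linarith),
            indicator_of_notMem (show x - t ∉ Ioi 0 by simpa using h1.le)]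
          simp
      · rw [indicator_of_notMem (show t ∉ Ioi 0 from ht0), hf,
          indicator_of_notMem (show t ∉ Ioi 0 from ht0)]
        simp
    · rw [indicator_of_notMem (show x ∉ Ioi 0 from hx)]
      have : ∀ t, f t * g (x - t) = 0 := by
        intro t
        by_cases ht0 : 0 < t
        · have : x - t ∉ Ioi 0 := by simp; linarith
          rw [hg, indicator_of_notMem this, mul_zero]
        · rw [hf, indicator_of_notMem (show t ∉ Ioi 0 from ht0), zero_mul]
      simp [this]
  rw [key] at hc hv
  refine ⟨(integrable_indicator_iff measurableSet_Ioi).1 hc, ?_⟩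
  rw [integral_indicator measurableSet_Ioi] at hv
  rw [hv, ContinuousLinearMap.mul_apply', integral_indicator measurableSet_Ioi,
    integral_indicator measurableSet_Ioi, hkv]

lemma renewal (hBVσ : L.σ2 = 0)
    (hBVPi : ∫⁻ y in Set.Ioo (-1 : ℝ) 0, ENNReal.ofReal (-y) ∂ L.levyMeasure ≠ ⊤)
    (hNP : 0 < derivWithin L.ψ (Set.Ici 0) 0)
    {q : ℝ} (hq : 0 ≤ q) {x : ℝ} (hx : 0 ≤ x) : L.cc * L.W q x = 1 + L.conv q x := by
  have hc := L.cc_pos hBVσ hBVPi hNP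
  have hcont : Continuous (fun x => (1 + L.conv q x) / L.cc) :=
    (continuous_const.add (L.conv_cont hBVPi hq)).div_const _
  have h := L.Wuniq q hq (fun x => (1 + L.conv q x) / L.cc) hcont.continuousOn (by
    intro lam hl
    obtain ⟨hlp, hi, hψ⟩ := L.Phi_facts hBVσ hBVPi hNP hq hl
    obtain ⟨h1, h2⟩ := L.lap_conv hBVPi hq hlp hi
    have h3 := integrableOn_exp_mul_Ioi (neg_lt_zero.2 hlp) 0
    have e : (fun y => Real.exp (-lam * y) * ((1 + L.conv q y) / L.cc)) =
      fun y => (Real.exp (-lam * y) + Real.exp (-lam * y) * L.conv q y) / L.cc := by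
      ext y; ring
    rw [e, integral_div, integral_add h3 h1, h2, L.Wlaplace q hq lam hl,
      integral_exp_mul_Ioi (neg_lt_zero.2 hlp) 0]
    have hne : L.ψ lam - q ≠ 0 := by linarith
    rw [L.psi_eq' hBVσ hBVPi hlp] at hne ⊢
    simp only [mul_zero, Real.exp_zero]
    field_simp
    ring)
  have hpos : ∀ x, 0 < x → (1 + L.conv q x) / L.cc = L.W q x := fun x hx => h hx
  have h0 : (1 + L.conv q 0) / L.cc = L.W q 0 := by
    have t1 : Tendsto (L.W q) (nhdsWithin 0 (Ioi 0)) (nhds (L.W q 0)) :=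
      ((L.Wcont0 hq) 0 (by simp)).mono_left (nhdsWithin_mono _ Ioi_subset_Ici_self)
    have t2 : Tendsto (fun x => (1 + L.conv q x) / L.cc) (nhdsWithin 0 (Ioi 0))
      (nhds ((1 + L.conv q 0) / L.cc)) := (hcont.tendsto 0).mono_left nhdsWithin_le_nhds
    refine tendsto_nhds_unique t2 (t1.congr' ?_)
    filter_upwards [self_mem_nhdsWithin] with y hy
    exact (hpos y hy).symm
  have : (1 + L.conv q x) / L.cc = L.W q x := by
    rcases eq_or_lt_of_le hx with h | h
    · rw [← h]; exact h0
    · exact hpos x h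
  rw [← this]; field_simp

lemma conv_nonneg {q : ℝ} (hq : 0 ≤ q) (x : ℝ) : 0 ≤ L.conv q x :=
  integral_nonneg fun z => mul_nonneg (add_nonneg (L.tl_nonneg z) hq) (L.Wnonneg q hq _)

lemma W_mono (hBVσ : L.σ2 = 0)
    (hBVPi : ∫⁻ y in Set.Ioo (-1 : ℝ) 0, ENNReal.ofReal (-y) ∂ L.levyMeasure ≠ ⊤)
    (hNP : 0 < derivWithin L.ψ (Set.Ici 0) 0)
    {q : ℝ} (hq : 0 ≤ q) {x y : ℝ} (hx : 0 ≤ x) (hxy : x ≤ y) : L.W q x ≤ L.W q y := by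
  have hc := L.cc_pos hBVσ hBVPi hNP
  obtain ⟨hlp, hi, hψ⟩ := L.Phi_facts hBVσ hBVPi hNP hq (lt_add_one (L.Φ q))
  set lam := L.Φ q + 1 with hlam
  obtain ⟨hk, hkv⟩ := L.lap_k hBVPi q hlp
  have hkc : L.KK lam + q / lam < L.cc := by
    rw [L.psi_eq' hBVσ hBVPi hlp] at hψ
    have : q / lam < L.cc - L.KK lam := by rw [div_lt_iff₀ hlp]; linarith
    linarith
  obtain ⟨h, rfl⟩ : ∃ h, y = x + h := ⟨y - x, by ring⟩
  have hh : 0 ≤ h := by linarith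
  by_contra hcon
  push Not at hcon
  set E : ℝ → ℝ := fun s => Real.exp (-lam * s) * (L.W q (s + h) - L.W q s) with hE
  have hEc : ContinuousOn E (Icc 0 x) := by
    refine ContinuousOn.mul (by fun_prop) (ContinuousOn.sub ?_ ?_)
    · exact (L.Wcont0 hq).comp (f := fun s => s + h) (by fun_prop)
        (fun s hs => by have := hs.1; simp; linarith)
    · exact (L.Wcont0 hq).mono Icc_subset_Ici_self
  obtain ⟨x0, hx0, hmin⟩ := isCompact_Icc.exists_isMinOn (nonempty_Icc.2 hx) hEc
  have hE0 : E x0 < 0 := by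
    refine (hmin (show x ∈ Icc 0 x from ⟨hx, le_rfl⟩)).trans_lt ?_
    exact mul_neg_of_pos_of_neg (Real.exp_pos _) (by linarith)
  have hD : ∀ s ∈ Icc 0 x, E x0 * Real.exp (lam * s) ≤ L.W q (s + h) - L.W q s := by
    intro s hs
    have h1 : E x0 ≤ E s := hmin hs
    have h2 := mul_le_mul_of_nonneg_right h1 (Real.exp_pos (lam * s)).le
    refine h2.trans (le_of_eq ?_)
    simp only [hE]
    rw [mul_right_comm, ← Real.exp_add]; simp
  have i1 := L.conv_int hBVPi hq (x0 + h)
  have i2 := L.conv_int hBVPi hq x0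
  have hle : ∫ z in Ioi 0, (E x0 * Real.exp (lam * x0)) * (Real.exp (-lam * z) * (L.tl z + q)) ≤
      ∫ z in Ioi 0, ((L.tl z + q) * L.W q (x0 + h - z) - (L.tl z + q) * L.W q (x0 - z)) := by
    refine setIntegral_mono_on (hk.const_mul _) (i1.sub i2) measurableSet_Ioi fun z hz => ?_
    have hz : 0 < z := hz
    have hkz : 0 ≤ L.tl z + q := add_nonneg (L.tl_nonneg z) hq
    by_cases hzx : z ≤ x0
    · have h1 := hD (x0 - z) ⟨by linarith, by linarith [hx0.2]⟩
      have h2 := mul_le_mul_of_nonneg_left h1 hkz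
      have h3 : Real.exp (lam * (x0 - z)) = Real.exp (lam * x0) * Real.exp (-lam * z) := by
        rw [← Real.exp_add]; ring_nf
      rw [h3, show x0 - z + h = x0 + h - z by ring] at h2
      linarith
    · rw [L.Wzero q hq (x0 - z) (by linarith), mul_zero, sub_zero]
      refine le_trans ?_ (mul_nonneg hkz (L.Wnonneg q hq _))
      refine mul_nonpos_of_nonpos_of_nonneg ?_ (mul_nonneg (Real.exp_pos _).le hkz)
      exact mul_nonpos_of_nonpos_of_nonneg hE0.le (Real.exp_pos _).le
  rw [integral_sub i1 i2, integral_const_mul, hkv] at hle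
  change _ ≤ L.conv q (x0 + h) - L.conv q x0 at hle
  have r1 := L.renewal hBVσ hBVPi hNP hq (show 0 ≤ x0 + h by linarith [hx0.1])
  have r2 := L.renewal hBVσ hBVPi hNP hq hx0.1
  have e0 : L.W q (x0 + h) - L.W q x0 = E x0 * Real.exp (lam * x0) := by
    simp only [hE]
    rw [mul_right_comm, ← Real.exp_add]; simp
  have hneg : E x0 * Real.exp (lam * x0) < 0 := mul_neg_of_neg_of_pos hE0 (Real.exp_pos _)
  nlinarith

lemma W_pos (hBVσ : L.σ2 = 0)
    (hBVPi : ∫⁻ y in Set.Ioo (-1 : ℝ) 0, ENNReal.ofReal (-y) ∂ L.levyMeasure ≠ ⊤)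
    (hNP : 0 < derivWithin L.ψ (Set.Ici 0) 0)
    {q : ℝ} (hq : 0 ≤ q) {x : ℝ} (hx : 0 ≤ x) : 0 < L.W q x := by
  have hc := L.cc_pos hBVσ hBVPi hNP
  have r := L.renewal hBVσ hBVPi hNP hq hx
  have := L.conv_nonneg hq x
  refine (pos_iff_pos_of_mul_pos (by linarith : 0 < L.cc * L.W q x)).1 hc

lemma inner_bound (hBVσ : L.σ2 = 0)
    (hBVPi : ∫⁻ y in Set.Ioo (-1 : ℝ) 0, ENNReal.ofReal (-y) ∂ L.levyMeasure ≠ ⊤)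
    (hNP : 0 < derivWithin L.ψ (Set.Ici 0) 0)
    {q : ℝ} (hq : 0 ≤ q) {y Y : ℝ} (hy : 0 < y) (hY : 0 ≤ Y) :
    0 ≤ ∫ u in Set.Ioo (-(y + Y)) (-y), L.W q (y + u + Y) / L.W q Y ∂ L.levyMeasure ∧
    ∫ u in Set.Ioo (-(y + Y)) (-y), L.W q (y + u + Y) / L.W q Y ∂ L.levyMeasure ≤ L.tl y := by
  have hWY := L.W_pos hBVσ hBVPi hNP hq hY
  have hsub : Ioo (-(y + Y)) (-y) ⊆ Iic (-y) := fun u hu => hu.2.le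
  have hfin := L.tail_fin hy
  have hnn : ∀ u, 0 ≤ L.W q (y + u + Y) / L.W q Y := fun u =>
    div_nonneg (L.Wnonneg q hq _) hWY.le
  refine ⟨integral_nonneg fun u => hnn u, ?_⟩
  have h := norm_setIntegral_le_of_norm_le_const (μ := L.levyMeasure) (C := 1)
    (f := fun u => L.W q (y + u + Y) / L.W q Y)
    (lt_of_le_of_lt (measure_mono hsub) (lt_top_iff_ne_top.2 hfin)) (by
      intro u hu
      rw [Real.norm_eq_abs, abs_of_nonneg (hnn u), div_le_one hWY]
      exact L.W_mono hBVσ hBVPi hNP hq (by linarith [hu.1]) (by linarith [hu.2]))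
  rw [one_mul] at h
  exact (le_abs_self _).trans (h.trans (measureReal_mono hsub hfin))

lemma outer_bound (hBVσ : L.σ2 = 0)
    (hBVPi : ∫⁻ y in Set.Ioo (-1 : ℝ) 0, ENNReal.ofReal (-y) ∂ L.levyMeasure ≠ ⊤)
    (hNP : 0 < derivWithin L.ψ (Set.Ici 0) 0)
    {q : ℝ} (hq : 0 ≤ q) {b Y : ℝ} (hb : 0 < b) (hY : 0 ≤ Y) :
    0 ≤ ∫ y in Set.Ioi (0 : ℝ), L.H q b y *
      ∫ u in Set.Ioo (-(y + Y)) (-y), L.W q (y + u + Y) / L.W q Y ∂ L.levyMeasure ∧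
    ∫ y in Set.Ioi (0 : ℝ), L.H q b y *
      ∫ u in Set.Ioo (-(y + Y)) (-y), L.W q (y + u + Y) / L.W q Y ∂ L.levyMeasure
      ≤ L.cc - 1 / L.W q b := by
  have hWb := L.W_pos hBVσ hBVPi hNP hq hb.le
  have hH : ∀ y, 0 < y → L.H q b y = L.W q (b - y) / L.W q b := by
    intro y hy
    rw [H, L.Wzero q hq (-y) (by linarith)]; simp
  have hH0 : ∀ y, 0 < y → 0 ≤ L.H q b y := fun y hy => by
    rw [hH y hy]; exact div_nonneg (L.Wnonneg q hq _) hWb.le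
  have hnn : ∀ y, 0 < y → 0 ≤ L.H q b y *
      ∫ u in Set.Ioo (-(y + Y)) (-y), L.W q (y + u + Y) / L.W q Y ∂ L.levyMeasure :=
    fun y hy => mul_nonneg (hH0 y hy) (L.inner_bound hBVσ hBVPi hNP hq hy hY).1
  refine ⟨setIntegral_nonneg measurableSet_Ioi fun y hy => hnn y hy, ?_⟩
  have h1 : ∫ y in Set.Ioi (0 : ℝ), L.H q b y *
      ∫ u in Set.Ioo (-(y + Y)) (-y), L.W q (y + u + Y) / L.W q Y ∂ L.levyMeasure ≤
      ∫ y in Ioi 0, (L.tl y + q) * L.W q (b - y) / L.W q b := by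
    refine integral_mono_of_nonneg ?_ ((L.conv_int hBVPi hq b).div_const _) ?_
    · filter_upwards [ae_restrict_mem measurableSet_Ioi] with y hy
      exact hnn y hy
    · filter_upwards [ae_restrict_mem measurableSet_Ioi] with y hy
      have h2 := mul_le_mul_of_nonneg_left
        ((L.inner_bound hBVσ hBVPi hNP hq hy hY).2.trans (le_add_of_nonneg_right hq)) (hH0 y hy)
      refine h2.trans (le_of_eq ?_)
      rw [hH y hy]; ring
  refine h1.trans (le_of_eq ?_)
  rw [integral_div]
  change L.conv q b / _ = _
  have r := L.renewal hBVσ hBVPi hNP hq hb.le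
  rw [eq_sub_of_add_eq' r.symm]
  field_simp

end SNLevy

/-- The denominator in the bounded variation Gerber–Shiu formula is strictly positive:
`W^{(q)}(0+) · 𝔼[∫_0^∞ H^{(q)}(b,y) ∫_{(-y-Y,-y)} W^{(q)}(y+x+Y)/W^{(q)}(Y) Π(dx) dy] < 1`. -/
theorem statement4 {Ω : Type} [MeasurableSpace Ω] (L : SNLevy Ω)
    (hBVσ : L.σ2 = 0)
    (hBVPi : ∫⁻ y in Set.Ioo (-1 : ℝ) 0, ENNReal.ofReal (-y) ∂ L.levyMeasure ≠ ⊤)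
    (hNP : 0 < derivWithin L.ψ (Set.Ici 0) 0)
    (q : ℝ) (hq : 0 ≤ q) (b : ℝ) (hb : 0 < b)
    (Y : Ω → ℝ) (hYm : Measurable Y) (hY0 : ∀ᵐ ω ∂ L.P 0, 0 ≤ Y ω)
    (hYX : Indep (MeasurableSpace.comap Y inferInstance)
      (⨆ t : ℝ, MeasurableSpace.comap (L.X t) inferInstance) (L.P 0)) :
    L.W q 0 *
        (∫ ω, (∫ y in Set.Ioi (0 : ℝ), L.H q b y *
          ∫ u in Set.Ioo (-(y + Y ω)) (-y),
            L.W q (y + u + Y ω) / L.W q (Y ω) ∂ L.levyMeasure) ∂ L.P 0) < 1 ∧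
      0 < 1 / L.W q 0 -
        ∫ ω, (∫ y in Set.Ioi (0 : ℝ), L.H q b y *
          ∫ u in Set.Ioo (-(y + Y ω)) (-y),
            L.W q (y + u + Y ω) / L.W q (Y ω) ∂ L.levyMeasure) ∂ L.P 0 := by
  have hc := L.cc_pos hBVσ hBVPi hNP
  have hWb := L.W_pos hBVσ hBVPi hNP hq hb.le
  have r0 := L.renewal hBVσ hBVPi hNP hq (le_refl 0)
  rw [L.conv_zero hq, add_zero] at r0
  have hW0 : L.W q 0 = 1 / L.cc := by field_simp; linarith
  have hlt : (∫ ω, (∫ y in Set.Ioi (0 : ℝ), L.H q b y *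
          ∫ u in Set.Ioo (-(y + Y ω)) (-y),
            L.W q (y + u + Y ω) / L.W q (Y ω) ∂ L.levyMeasure) ∂ L.P 0) < L.cc := by
    haveI := L.probP 0
    have h : (∫ ω, (∫ y in Set.Ioi (0 : ℝ), L.H q b y *
          ∫ u in Set.Ioo (-(y + Y ω)) (-y),
            L.W q (y + u + Y ω) / L.W q (Y ω) ∂ L.levyMeasure) ∂ L.P 0) ≤
        ∫ _, (L.cc - 1 / L.W q b) ∂ L.P 0 := by
      refine integral_mono_of_nonneg ?_ (integrable_const _) ?_
      · filter_upwards [hY0] with ω hω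
        exact (L.outer_bound hBVσ hBVPi hNP hq hb hω).1
      · filter_upwards [hY0] with ω hω
        exact (L.outer_bound hBVσ hBVPi hNP hq hb hω).2
    rw [integral_const] at h
    simp only [probReal_univ, one_smul] at h
    have : 0 < 1 / L.W q b := by positivity
    linarith
  rw [hW0, one_div_one_div]
  refine ⟨?_, by linarith⟩
  rw [div_mul_eq_mul_div, one_mul, div_lt_one hc]
  exact hlt

end
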